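/- Let k ≥ 3 and let f₁, f₂ be multisets on 𝔽₂^{k−1} with distinguishing number k (i.e., (k−1)-indistinguishable but k-distinguishable) which are in standard position. Then there exist distinct non-negative integers a, b, positive integers a₁, …, a_{k−1}, and elements x₁, x₂ ∈ 𝔽₂^{k−1} such that x₁ + f₁ = f_{(a,b),(a₁,…,a_{k−1})} and x₂ + f₂ = f_{(b,a),(a₁,…,a_{k−1})}. -/

import Mathlib

open Finset

/-- The `k`-deck of a multiset `φ : G → ℕ`. -/
def deck {G : Type*} [Fintype G] [AddCommGroup G] (k : ℕ) (φ : G → ℕ) :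
    (Fin k → G) → ℕ :=
  fun s => ∑ g : G, ∏ i, φ (g + s i)

/-- `φ` and `ψ` are `k`-indistinguishable if their `i`-decks agree for all `i ≤ k`. -/
def Indist {G : Type*} [Fintype G] [AddCommGroup G] (k : ℕ) (φ ψ : G → ℕ) : Prop :=
  ∀ i, i ≤ k → deck i φ = deck i ψ

/-- The character pairing `⟨x,y⟩ = (−1)^(∑ xᵢyᵢ) ∈ ℤ` on `𝔽₂^n`. -/
def chr {n : ℕ} (x y : Fin n → ZMod 2) : ℤ :=
  (-1 : ℤ) ^ (∑ i, x i * y i).val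

/-- The Fourier transform of a multiset `φ : 𝔽₂^n → ℕ`, viewed as taking values in `ℤ`. -/
def ftN {n : ℕ} (φ : (Fin n → ZMod 2) → ℕ) : (Fin n → ZMod 2) → ℤ :=
  fun x => ∑ y, (φ y : ℤ) * chr x y

/-- The standard multiset `f_{(a,b),(a₁,…,a_m)} : 𝔽₂^m → ℕ`, taking value
`a + ∑ aᵢxᵢ` when `∑ xᵢ` is even and `b + ∑ aᵢxᵢ` when `∑ xᵢ` is odd. -/
def stdM {m : ℕ} (a b : ℕ) (c : Fin m → ℕ) : (Fin m → ZMod 2) → ℕ :=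
  fun x => (if (∑ i, x i) = 0 then a else b) + ∑ i, c i * (x i).val

/-- The nontrivial additive character `a ↦ (-1)^a` of `𝔽₂`, with values in `ℤ`. -/
def signChar (a : ZMod 2) : ℤ := (-1) ^ a.val

lemma signChar_zero : signChar 0 = 1 := rfl

lemma signChar_one : signChar 1 = -1 := rfl

lemma signChar_add (a b : ZMod 2) : signChar (a + b) = signChar a * signChar b := by
  revert a b; decide

lemma signChar_mul_self (a : ZMod 2) : signChar a * signChar a = 1 := by
  revert a; decide

lemma signChar_eq_ite (a : ZMod 2) : signChar a = if a = 0 then 1 else -1 := by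
  revert a; decide

lemma signChar_eq_one_sub (a : ZMod 2) : signChar a = 1 - 2 * (a.val : ℤ) := by
  revert a; decide

lemma signChar_sum {ι : Type*} (s : Finset ι) (v : ι → ZMod 2) :
    signChar (∑ i ∈ s, v i) = ∏ i ∈ s, signChar (v i) := by
  classical
  induction s using Finset.induction_on with
  | empty => simp [signChar_zero]
  | insert a s ha ih => rw [sum_insert ha, prod_insert ha, signChar_add, ih]

lemma eq_one_of_ne_zero_zmodTwo {a : ZMod 2} (h : a ≠ 0) : a = 1 := by
  revert a; decide

section Fourier

variable {n : ℕ}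

lemma chr_eq_signChar (x y : Fin n → ZMod 2) : chr x y = signChar (∑ i, x i * y i) := rfl

lemma chr_comm (x y : Fin n → ZMod 2) : chr x y = chr y x := by
  simp only [chr, mul_comm]

lemma chr_add_left (x y z : Fin n → ZMod 2) : chr (x + y) z = chr x z * chr y z := by
  simp only [chr_eq_signChar, ← signChar_add, ← sum_add_distrib, Pi.add_apply, add_mul]

lemma chr_add_right (x y z : Fin n → ZMod 2) : chr x (y + z) = chr x y * chr x z := by
  rw [chr_comm, chr_add_left, chr_comm y, chr_comm z]

lemma chr_zero_left (y : Fin n → ZMod 2) : chr 0 y = 1 := by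
  simp [chr]

lemma chr_mul_self (x y : Fin n → ZMod 2) : chr x y * chr x y = 1 :=
  signChar_mul_self _

lemma chr_single (i : Fin n) (y : Fin n → ZMod 2) : chr (Pi.single i 1) y = signChar (y i) := by
  simp [chr_eq_signChar, Pi.single_apply]

lemma chr_one_left (y : Fin n → ZMod 2) : chr (fun _ => 1) y = signChar (∑ i, y i) := by
  simp [chr_eq_signChar]

lemma chr_sum_left {ι : Type*} (s : Finset ι) (v : ι → Fin n → ZMod 2) (y : Fin n → ZMod 2) :
    chr (∑ j ∈ s, v j) y = ∏ j ∈ s, chr (v j) y := by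
  classical
  induction s using Finset.induction_on with
  | empty => simp [chr_zero_left]
  | insert a s ha ih => rw [sum_insert ha, prod_insert ha, chr_add_left, ih]

lemma sum_chr_eq_zero {z : Fin n → ZMod 2} (hz : z ≠ 0) : ∑ x, chr x z = 0 := by
  obtain ⟨i, hi⟩ := Function.ne_iff.1 hz
  have hi : z i = 1 := eq_one_of_ne_zero_zmodTwo hi
  have h : ∑ x, chr (x + Pi.single i 1) z = ∑ x, chr x z :=
    Equiv.sum_comp (Equiv.addRight (Pi.single i 1)) fun x => chr x z
  simp only [chr_add_left, chr_single, hi, signChar_one, ← sum_mul] at h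
  linarith

lemma add_self_zmodTwo (x : Fin n → ZMod 2) : x + x = 0 := by
  ext i; exact CharTwo.add_self_eq_zero (x i)

/-- Fourier inversion on `𝔽₂ⁿ`. -/
lemma sum_ftN_mul_chr (φ : (Fin n → ZMod 2) → ℕ) (s : Fin n → ZMod 2) :
    ∑ x, ftN φ x * chr x s = 2 ^ n * (φ s : ℤ) := by
  simp only [ftN, sum_mul]
  rw [sum_comm, sum_eq_single s]
  · have h (x : Fin n → ZMod 2) : (φ s : ℤ) * chr x s * chr x s = φ s := by
      rw [mul_assoc, chr_mul_self, mul_one]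
    simp [h]
  · intro y _ hy
    simp only [mul_assoc, ← chr_add_right, ← mul_sum]
    rw [sum_chr_eq_zero, mul_zero]
    intro h
    apply hy
    rw [← add_zero y, ← add_self_zmodTwo s, ← add_assoc, h, zero_add]
  · simp

lemma ftN_shift (φ : (Fin n → ZMod 2) → ℕ) (g x : Fin n → ZMod 2) :
    ∑ t, (φ (g + t) : ℤ) * chr x t = ftN φ x * chr x g := by
  have h : ∑ t, (φ (g + t) : ℤ) * chr x (g + t) = ftN φ x :=
    Equiv.sum_comp (Equiv.addLeft g) fun t => (φ t : ℤ) * chr x t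
  rw [← h, sum_mul]
  refine sum_congr rfl fun t _ => ?_
  rw [chr_add_right]
  linear_combination (-(φ (g + t) : ℤ) * chr x t) * chr_mul_self x g

/-- The Fourier transform of the `i`-deck at a tuple with sum zero. -/
lemma sum_deck_mul_chr {i : ℕ} (φ : (Fin n → ZMod 2) → ℕ) (x : Fin i → Fin n → ZMod 2)
    (hx : ∑ j, x j = 0) :
    ∑ s, (deck i φ s : ℤ) * ∏ j, chr (x j) (s j) = 2 ^ n * ∏ j, ftN φ (x j) := by
  have h (g : Fin n → ZMod 2) :
      ∑ s : Fin i → Fin n → ZMod 2, ∏ j, ((φ (g + s j) : ℤ) * chr (x j) (s j)) =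
        ∏ j, ftN φ (x j) := by
    rw [← Fintype.prod_sum fun j t => (φ (g + t) : ℤ) * chr (x j) t]
    simp only [ftN_shift, prod_mul_distrib]
    rw [← chr_sum_left, hx, chr_zero_left, mul_one]
  simp only [deck, Nat.cast_sum, Nat.cast_prod, sum_mul, ← prod_mul_distrib]
  rw [sum_comm]
  simp [h]

lemma Indist.prod_ftN_eq {m : ℕ} {f₁ f₂ : (Fin n → ZMod 2) → ℕ} (h : Indist m f₁ f₂)
    (s : Multiset (Fin n → ZMod 2)) (hcard : s.card ≤ m) (hsum : s.sum = 0) :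
    (s.map (ftN f₁)).prod = (s.map (ftN f₂)).prod := by
  induction s using Quotient.inductionOn with
  | h l =>
    simp only [Multiset.quot_mk_to_coe, Multiset.coe_card, Multiset.sum_coe] at hcard hsum
    have hx : ∑ j, l.get j = 0 := by simpa using hsum
    have h₁ := sum_deck_mul_chr f₁ l.get hx
    rw [h _ hcard, sum_deck_mul_chr f₂ l.get hx] at h₁
    have h₂ := mul_left_cancel₀ (by positivity) h₁
    simpa [Fin.prod_univ_fun_getElem] using h₂.symm

lemma eq_sum_single (x : Fin n → ZMod 2) :
    x = ∑ i with x i = 1, Pi.single i 1 := by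
  conv_lhs => rw [← Finset.univ_sum_single x]
  rw [sum_filter]
  refine sum_congr rfl fun i _ => ?_
  split_ifs with h
  · rw [h]
  · rw [not_imp_comm.1 eq_one_of_ne_zero_zmodTwo h, Pi.single_zero]

variable {f₁ f₂ : (Fin n → ZMod 2) → ℕ}

lemma Indist.ftN_sq_eq (h : Indist n f₁ f₂) (hn : 2 ≤ n) (x : Fin n → ZMod 2) :
    ftN f₁ x ^ 2 = ftN f₂ x ^ 2 := by
  simpa [sq] using h.prod_ftN_eq {x, x} (by simpa) (by simpa using add_self_zmodTwo x)

lemma Indist.ftN_zero_eq (h : Indist n f₁ f₂) (hn : 2 ≤ n) : ftN f₁ 0 = ftN f₂ 0 := by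
  simpa using h.prod_ftN_eq {0} (by simp; omega) (by simp)

/-- Under standard position, the transform vanishes away from `0`, the basis vectors, and their
sum: any other frequency splits the critical relation into two shorter ones. -/
lemma Indist.ftN_eq_zero (h : Indist n f₁ f₂) (hn : 2 ≤ n)
    (hstd : (∏ i, ftN f₁ (Pi.single i 1)) * ftN f₁ (fun _ => 1) ≠
      (∏ i, ftN f₂ (Pi.single i 1)) * ftN f₂ (fun _ => 1))
    {x : Fin n → ZMod 2} (h0 : x ≠ 0) (h1 : x ≠ fun _ => 1)
    (he : ∀ i, x ≠ Pi.single i 1) : ftN f₁ x = 0 := by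
  classical
  set S : Finset (Fin n) := univ.filter fun i => x i = 1 with hS
  have hxS : x = ∑ i ∈ S, Pi.single i 1 := eq_sum_single x
  have hone : (fun _ => 1 : Fin n → ZMod 2) = ∑ i, Pi.single i 1 :=
    (Finset.univ_sum_single _).symm
  have hS0 : S.card ≠ 0 := fun hc => h0 <| by rw [hxS, card_eq_zero.1 hc, sum_empty]
  have hS1 : S.card ≠ 1 := fun hc => by
    obtain ⟨i, hi⟩ := card_eq_one.1 hc
    exact he i (by rw [hxS, hi, sum_singleton])
  have hSn : S.card ≠ n := fun hc => h1 <| by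
    rw [hone, hxS, (card_eq_iff_eq_univ S).1 (by simpa using hc)]
  have hSle : S.card ≤ n := by simpa using S.card_le_univ
  have hSc : Sᶜ.card = n - S.card := by simp [card_compl]
  have key₁ := h.prod_ftN_eq (x ::ₘ S.1.map fun i => Pi.single i 1)
    (by simp; omega) (by
      rw [Multiset.sum_cons]
      change x + ∑ i ∈ S, Pi.single i 1 = 0
      rw [← hxS, add_self_zmodTwo])
  have key₂ := h.prod_ftN_eq (x ::ₘ (fun _ => 1) ::ₘ Sᶜ.1.map fun i => Pi.single i 1)
    (by
      simp only [Multiset.card_cons, Multiset.card_map, Finset.card_val]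
      omega) (by
      rw [Multiset.sum_cons, Multiset.sum_cons]
      change x + ((fun _ => 1) + ∑ i ∈ Sᶜ, Pi.single i 1) = 0
      rw [add_left_comm]
      nth_rw 1 [hxS]
      rw [sum_add_sum_compl, ← hone, add_self_zmodTwo])
  simp only [Multiset.map_cons, Multiset.prod_cons, Multiset.map_map] at key₁ key₂
  change ftN f₁ x * ∏ i ∈ S, ftN f₁ (Pi.single i 1) =
    ftN f₂ x * ∏ i ∈ S, ftN f₂ (Pi.single i 1) at key₁
  change ftN f₁ x * (ftN f₁ (fun _ => 1) * ∏ i ∈ Sᶜ, ftN f₁ (Pi.single i 1)) =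
    ftN f₂ x * (ftN f₂ (fun _ => 1) * ∏ i ∈ Sᶜ, ftN f₂ (Pi.single i 1)) at key₂
  rw [← prod_mul_prod_compl S, ← prod_mul_prod_compl S] at hstd
  have hsq := h.ftN_sq_eq hn x
  have hprod := congrArg₂ (· * ·) key₁ key₂
  simp only at hprod
  have hz : ftN f₁ x ^ 2 * (((∏ i ∈ S, ftN f₁ (Pi.single i 1)) *
      (∏ i ∈ Sᶜ, ftN f₁ (Pi.single i 1)) * ftN f₁ (fun _ => 1)) -
      ((∏ i ∈ S, ftN f₂ (Pi.single i 1)) *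
      (∏ i ∈ Sᶜ, ftN f₂ (Pi.single i 1)) * ftN f₂ (fun _ => 1))) = 0 := by
    linear_combination hprod - ((∏ i ∈ S, ftN f₂ (Pi.single i 1)) *
      (∏ i ∈ Sᶜ, ftN f₂ (Pi.single i 1)) * ftN f₂ (fun _ => 1)) * hsq
  rcases mul_eq_zero.1 hz with hz | hz
  · exact pow_eq_zero_iff two_ne_zero |>.1 hz
  · exact absurd (sub_eq_zero.1 hz) hstd

/-- A sum over `𝔽₂ⁿ` of a function supported on `0`, the basis vectors, and their sum. -/
lemma sum_eq_of_support (hn : 2 ≤ n) (F : (Fin n → ZMod 2) → ℤ)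
    (hF : ∀ x, x ≠ 0 → x ≠ (fun _ => 1) → (∀ i, x ≠ Pi.single i 1) → F x = 0) :
    ∑ x, F x = F 0 + ∑ i, F (Pi.single i 1) + F (fun _ => 1) := by
  classical
  have hinj : Function.Injective fun i : Fin n => (Pi.single i 1 : Fin n → ZMod 2) := by
    intro i j hij
    by_contra hne
    simpa [hne] using congrFun hij i
  have h01 : (0 : Fin n → ZMod 2) ≠ fun _ => 1 := fun h0 => by
    simpa using congrFun h0 ⟨0, by omega⟩
  have h1e (i : Fin n) : (Pi.single i 1 : Fin n → ZMod 2) ≠ fun _ => 1 := fun h => by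
    have : Nontrivial (Fin n) := Fin.nontrivial_iff_two_le.2 hn
    obtain ⟨j, hj⟩ := exists_ne i
    simpa [hj] using congrFun h j
  have hsub : ∑ x ∈ insert 0 (insert (fun _ => 1)
      (univ.image fun i : Fin n => (Pi.single i 1 : Fin n → ZMod 2))), F x = ∑ x, F x := by
    refine sum_subset (subset_univ _) fun x _ hx => ?_
    simp only [mem_insert, mem_image, mem_univ, true_and, not_or, not_exists] at hx
    exact hF x hx.1 hx.2.1 fun i hi => hx.2.2 i hi.symm
  rw [← hsub, sum_insert, sum_insert, sum_image fun i _ j _ hij => hinj hij]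
  · ring
  · simp [h1e]
  · simp [h01]

/-- The translation making every Fourier coefficient at a basis vector nonpositive. -/
def normalizer (f : (Fin n → ZMod 2) → ℕ) : Fin n → ZMod 2 :=
  fun i => if ftN f (Pi.single i 1) < 0 then 0 else 1

lemma ftN_mul_signChar_normalizer (f : (Fin n → ZMod 2) → ℕ) (i : Fin n) :
    ftN f (Pi.single i 1) * signChar (normalizer f i) = -|ftN f (Pi.single i 1)| := by
  unfold normalizer
  split_ifs with h
  · rw [signChar_zero, abs_of_neg h]; ring
  · rw [signChar_one, abs_of_nonneg (not_lt.1 h)]; ring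

lemma two_pow_mul_normalize (hn : 2 ≤ n) {f : (Fin n → ZMod 2) → ℕ}
    (hf : ∀ x, x ≠ 0 → x ≠ (fun _ => 1) → (∀ i, x ≠ Pi.single i 1) → ftN f x = 0)
    (s : Fin n → ZMod 2) :
    2 ^ n * (f (s + normalizer f) : ℤ) =
      (ftN f 0 - ∑ i, |ftN f (Pi.single i 1)|)
        + 2 * ∑ i, |ftN f (Pi.single i 1)| * ((s i).val : ℤ)
        + ftN f (fun _ => 1) * signChar (∑ i, normalizer f i) * signChar (∑ i, s i) := by
  rw [← sum_ftN_mul_chr, sum_eq_of_support hn]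
  · have hterm (i : Fin n) : ftN f (Pi.single i 1) * signChar ((s + normalizer f) i) =
        -|ftN f (Pi.single i 1)| + 2 * (|ftN f (Pi.single i 1)| * ((s i).val : ℤ)) := by
      rw [Pi.add_apply, signChar_add, signChar_eq_one_sub (s i)]
      linear_combination (1 - 2 * ((s i).val : ℤ)) * ftN_mul_signChar_normalizer f i
    simp only [chr_zero_left, chr_single, chr_one_left, hterm]
    simp only [sum_add_distrib, Pi.add_apply, sum_neg_distrib, ← mul_sum, signChar_add]
    ring
  · intro x h0 h1 he
    rw [hf x h0 h1 he, zero_mul]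

lemma prod_ftN_eq_normalize (f : (Fin n → ZMod 2) → ℕ) :
    (∏ i, ftN f (Pi.single i 1)) * ftN f (fun _ => 1) =
      (∏ i, -|ftN f (Pi.single i 1)|) *
        (ftN f (fun _ => 1) * signChar (∑ i, normalizer f i)) := by
  simp only [← ftN_mul_signChar_normalizer, prod_mul_distrib, ← signChar_sum]
  linear_combination (-(∏ i, ftN f (Pi.single i 1)) * ftN f (fun _ => 1)) *
    signChar_mul_self (∑ i, normalizer f i)

/-- A function on `𝔽₂ⁿ` that is affine up to a multiple of the parity character is standard,
with parameters read off from its values and those of the opposite function. -/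
lemma eq_stdM {N D B : ℤ} (hN : 0 < N) {A : Fin n → ℤ} {a b : ℕ} {c : Fin n → ℕ}
    (ha : N * a = D + B) (hb : N * b = D - B) (hc : ∀ i, N * c i = 2 * A i)
    {g : (Fin n → ZMod 2) → ℕ}
    (hg : ∀ s, N * (g s : ℤ) = D + 2 * ∑ i, A i * ((s i).val : ℤ) + B * signChar (∑ i, s i)) :
    g = stdM a b c := by
  funext s
  have hsum : N * ∑ i, (c i : ℤ) * ((s i).val : ℤ) = 2 * ∑ i, A i * ((s i).val : ℤ) := by
    rw [mul_sum, mul_sum]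
    exact sum_congr rfl fun i _ => by linear_combination ((s i).val : ℤ) * hc i
  have h : N * (g s : ℤ) = N * (stdM a b c s : ℤ) := by
    rw [hg, signChar_eq_ite]
    simp only [stdM, Nat.cast_add, Nat.cast_sum, Nat.cast_mul]
    split_ifs
    · linear_combination -ha - hsum
    · linear_combination -hb - hsum
  exact_mod_cast mul_left_cancel₀ hN.ne' h

theorem Indist.exists_stdM (h : Indist n f₁ f₂) (hn : 2 ≤ n)
    (hstd : (∏ i, ftN f₁ (Pi.single i 1)) * ftN f₁ (fun _ => 1) ≠
      (∏ i, ftN f₂ (Pi.single i 1)) * ftN f₂ (fun _ => 1)) :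
    ∃ (a b : ℕ) (c : Fin n → ℕ) (x₁ x₂ : Fin n → ZMod 2),
      a ≠ b ∧ (∀ i, 0 < c i) ∧
      (fun s => f₁ (s + x₁)) = stdM a b c ∧
      (fun s => f₂ (s + x₂)) = stdM b a c := by
  have habs (x) : |ftN f₂ x| = |ftN f₁ x| := (sq_eq_sq_iff_abs_eq_abs _ _).1 (h.ftN_sq_eq hn x).symm
  have hsupp₁ := fun x h0 h1 he => h.ftN_eq_zero hn hstd (x := x) h0 h1 he
  have hsupp₂ : ∀ x, x ≠ 0 → x ≠ (fun _ => 1) → (∀ i, x ≠ Pi.single i 1) → ftN f₂ x = 0 :=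
    fun x h0 h1 he => by rw [← abs_eq_zero, habs, hsupp₁ x h0 h1 he, abs_zero]
  have hg₁ := two_pow_mul_normalize hn hsupp₁
  have hg₂ := two_pow_mul_normalize hn hsupp₂
  rw [prod_ftN_eq_normalize, prod_ftN_eq_normalize] at hstd
  simp only [habs, ← h.ftN_zero_eq hn] at hg₂ hstd
  set A : Fin n → ℤ := fun i => |ftN f₁ (Pi.single i 1)|
  set D : ℤ := ftN f₁ 0 - ∑ i, |ftN f₁ (Pi.single i 1)|
  set B₁ := ftN f₁ (fun _ => 1) * signChar (∑ i, normalizer f₁ i) with hB₁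
  set B₂ := ftN f₂ (fun _ => 1) * signChar (∑ i, normalizer f₂ i) with hB₂
  have hne : B₁ ≠ B₂ := fun he => hstd (by rw [he])
  have hB : B₂ = -B₁ := by
    have hsq : B₁ ^ 2 = B₂ ^ 2 := by
      rw [hB₁, hB₂]
      simp only [mul_pow, sq (signChar _), signChar_mul_self, h.ftN_sq_eq hn]
    rcases sq_eq_sq_iff_eq_or_eq_neg.1 hsq with h | h
    · exact absurd h hne
    · linarith
  have hApos (i : Fin n) : 0 < A i := by
    refine abs_pos.2 fun h0 => hstd ?_
    have : ∏ j, -|ftN f₁ (Pi.single j 1)| = 0 := prod_eq_zero (mem_univ i) (by simp [h0])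
    rw [this, zero_mul, zero_mul]
  rw [hB] at hg₂ hne
  have hN : (0 : ℤ) < 2 ^ n := by positivity
  have ha : (2 : ℤ) ^ n * (f₁ (0 + normalizer f₁) : ℤ) = D + B₁ := by
    simpa [signChar_zero] using hg₁ 0
  have hb : (2 : ℤ) ^ n * (f₂ (0 + normalizer f₂) : ℤ) = D - B₁ := by
    simpa [signChar_zero, sub_eq_add_neg] using hg₂ 0
  have he (i : Fin n) : (2 : ℤ) ^ n * (f₁ (Pi.single i 1 + normalizer f₁) : ℤ) =
      D + 2 * A i - B₁ := by
    have hval : ∑ j, A j * (((Pi.single i 1 : Fin n → ZMod 2) j).val : ℤ) = A i := by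
      rw [sum_eq_single i]
      · simp [ZMod.val_one]
      · intro j _ hj
        simp [hj]
      · simp
    have := hg₁ (Pi.single i 1)
    rw [hval, Finset.sum_pi_single' i (1 : ZMod 2) univ, if_pos (mem_univ i), signChar_one] at this
    linarith
  have hlt (i : Fin n) :
      f₂ (0 + normalizer f₂) < f₁ (Pi.single i 1 + normalizer f₁) := by
    have : (2 : ℤ) ^ n * (f₂ (0 + normalizer f₂) : ℤ) <
        2 ^ n * (f₁ (Pi.single i 1 + normalizer f₁) : ℤ) := by
      rw [he, hb]; linarith [hApos i]
    exact_mod_cast lt_of_mul_lt_mul_left this hN.le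
  have hc (i : Fin n) : (2 : ℤ) ^ n *
      ((f₁ (Pi.single i 1 + normalizer f₁) - f₂ (0 + normalizer f₂) : ℕ) : ℤ) = 2 * A i := by
    rw [Nat.cast_sub (hlt i).le, mul_sub, he, hb]; ring
  refine ⟨f₁ (0 + normalizer f₁), f₂ (0 + normalizer f₂),
    fun i => f₁ (Pi.single i 1 + normalizer f₁) - f₂ (0 + normalizer f₂),
    normalizer f₁, normalizer f₂, fun hab => hne ?_, fun i => Nat.sub_pos_of_lt (hlt i),
    eq_stdM hN ha hb hc hg₁, eq_stdM hN (B := -B₁) ?_ ?_ hc hg₂⟩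
  · rw [hab] at ha; linarith
  · rw [hb]; ring
  · rw [ha]; ring

end Fourier

/-- For `k ≥ 3`, if multisets `f₁`, `f₂` on `𝔽₂^(k-1)` have distinguishing number `k`
and are in standard position, then there are distinct non-negative integers `a ≠ b`,
positive integers `a₁,…,a_{k-1}` and elements `x₁, x₂ ∈ 𝔽₂^(k-1)` such that
`x₁ + f₁ = f_{(a,b),(a₁,…,a_{k-1})}` and `x₂ + f₂ = f_{(b,a),(a₁,…,a_{k-1})}`. -/
theorem stmt13 (k : ℕ) (hk : 3 ≤ k) (f₁ f₂ : (Fin (k - 1) → ZMod 2) → ℕ)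
    (hindist : Indist (k - 1) f₁ f₂) (hdist : ¬ Indist k f₁ f₂)
    (hstd : (∏ i, ftN f₁ (Pi.single i 1)) * ftN f₁ (fun _ => 1) ≠
            (∏ i, ftN f₂ (Pi.single i 1)) * ftN f₂ (fun _ => 1)) :
    ∃ (a b : ℕ) (c : Fin (k - 1) → ℕ) (x₁ x₂ : Fin (k - 1) → ZMod 2),
      a ≠ b ∧ (∀ i, 0 < c i) ∧
      (fun s => f₁ (s + x₁)) = stdM a b c ∧
      (fun s => f₂ (s + x₂)) = stdM b a c :=
  hindist.exists_stdM (by omega) hstd
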